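/- Fix m ∈ ℝ and c > 0 with 1 − G(−m/c) > 0, and let μ be the probability measure on ℝ with density y ↦ g((y−m)/c)·1_{[0,∞)}(y) / (c·(1 − G(−m/c))) with respect to Lebesgue measure. Set Δ' = (1−α)·(1 − G(−m/c)). Then the shortest interval J ⊆ [0,∞) with μ(J) = 1 − α is: (i) J = [0, m + c·G⁻¹(1 − α + α·G(−m/c))] when G(0) = 0, or when 0 < G(0) < 1 and m/c ≤ y₀; and (ii) J = [m − c·γ₁(Δ'), m + c·γ₂(Δ')] when G(0) = 1, or when 0 < G(0) < 1 and m/c ≥ y₀; here y₀ is the unique point with −y₀ in the interior of supp(g) satisfying U_{G,α}(y₀) = 0, and G⁻¹(p) denotes the unique point t of the interior of supp(g) with G(t) = p. -/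

import Mathlib

open Set Filter MeasureTheory

section UnimodalDensity

variable {g G : ℝ → ℝ}

lemma cdf_sub_eq (hg_int : Integrable g) (hG : ∀ y, G y = ∫ t in Iic y, g t) (a b : ℝ) :
    G b - G a = ∫ t in a..b, g t := by
  rw [hG, hG]
  exact intervalIntegral.integral_Iic_sub_Iic hg_int.integrableOn hg_int.integrableOn

lemma hasDerivAt_cdf (hg_cont : Continuous g) (hg_int : Integrable g)
    (hG : ∀ y, G y = ∫ t in Iic y, g t) (y : ℝ) : HasDerivAt G (g y) y := by
  have h : G = fun x => G 0 + ∫ t in (0 : ℝ)..x, g t := by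
    funext x
    rw [← cdf_sub_eq hg_int hG]
    ring
  rw [h]
  exact (intervalIntegral.integral_hasDerivAt_right (hg_cont.intervalIntegrable _ _)
    (hg_cont.stronglyMeasurableAtFilter _ _) hg_cont.continuousAt).const_add _

lemma monotone_of_hasDerivAt (hg_nonneg : ∀ t, 0 ≤ g t)
    (hd : ∀ y, HasDerivAt G (g y) y) : Monotone G :=
  monotone_of_deriv_nonneg (fun y => (hd y).differentiableAt)
    (fun y => by rw [(hd y).deriv]; exact hg_nonneg y)

lemma cdf_lt_of_lt_of_pos_left (hd : ∀ y, HasDerivAt G (g y) y) (hmono : Monotone G)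
    {a b : ℝ} (ha : g a ≠ 0) (hab : a < b) : G a < G b := by
  refine lt_of_le_of_ne (hmono hab.le) fun h => ha ?_
  have hmax : IsLocalMax G a := by
    filter_upwards [Iio_mem_nhds hab] with t ht
    exact h ▸ hmono (le_of_lt ht)
  exact hmax.hasDerivAt_eq_zero (hd a)

lemma cdf_lt_of_lt_of_pos_right (hd : ∀ y, HasDerivAt G (g y) y) (hmono : Monotone G)
    {a b : ℝ} (hb : g b ≠ 0) (hab : a < b) : G a < G b := by
  refine lt_of_le_of_ne (hmono hab.le) fun h => hb ?_
  have hmin : IsLocalMin G b := by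
    filter_upwards [Ioi_mem_nhds hab] with t ht
    exact h ▸ hmono (le_of_lt ht)
  exact hmin.hasDerivAt_eq_zero (hd b)

lemma cdf_nonneg (hg_nonneg : ∀ t, 0 ≤ g t) (hG : ∀ y, G y = ∫ t in Iic y, g t) (y : ℝ) :
    0 ≤ G y := by
  rw [hG]
  exact integral_nonneg hg_nonneg

lemma one_sub_cdf (hg_int : Integrable g) (hg_one : ∫ t, g t = 1)
    (hG : ∀ y, G y = ∫ t in Iic y, g t) (y : ℝ) : 1 - G y = ∫ t in Ioi y, g t := by
  have h := integral_add_compl (measurableSet_Iic (a := y)) hg_int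
  rw [compl_Iic, hg_one, ← hG] at h
  linarith

lemma cdf_le_one (hg_nonneg : ∀ t, 0 ≤ g t) (hg_int : Integrable g) (hg_one : ∫ t, g t = 1)
    (hG : ∀ y, G y = ∫ t in Iic y, g t) (y : ℝ) : G y ≤ 1 := by
  have h : 0 ≤ ∫ t in Ioi y, g t := integral_nonneg hg_nonneg
  linarith [one_sub_cdf hg_int hg_one hG y]

lemma exists_mem_ne_zero_of_setIntegral_ne_zero {s : Set ℝ}
    (h : ∫ t in s, g t ≠ 0) : ∃ t ∈ s, g t ≠ 0 := by
  by_contra! hc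
  exact h (setIntegral_eq_zero_of_forall_eq_zero hc)

lemma cdf_zero_ne_zero (hg_cont : Continuous g) (hg_nonneg : ∀ t, 0 ≤ g t)
    (hg_decr : StrictAntiOn g (Function.support g ∩ Ici 0))
    (hg_int : Integrable g) (hg_one : ∫ t, g t = 1)
    (hG : ∀ y, G y = ∫ t in Iic y, g t) : G 0 ≠ 0 := by
  intro h0
  have hmin : IsLocalMin G 0 := by
    filter_upwards with t
    rw [h0]
    exact cdf_nonneg hg_nonneg hG t
  have hg0 := hmin.hasDerivAt_eq_zero (hasDerivAt_cdf hg_cont hg_int hG 0)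
  obtain ⟨t, ht, hgt⟩ := exists_mem_ne_zero_of_setIntegral_ne_zero (g := g)
    (s := Ioi 0) (by rw [← one_sub_cdf hg_int hg_one hG, h0]; norm_num)
  have hpos : 0 < g t := lt_of_le_of_ne (hg_nonneg t) hgt.symm
  have ht' : (0 : ℝ) < t := ht
  obtain ⟨s, ⟨hs0, hst⟩, hs⟩ := intermediate_value_Icc ht'.le hg_cont.continuousOn
    (show g t / 2 ∈ Icc (g 0) (g t) by rw [hg0]; constructor <;> linarith)
  have hst' : s < t := lt_of_le_of_ne hst fun h => by rw [h] at hs; linarith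
  have := hg_decr (a := s) (b := t) ⟨by rw [Function.mem_support, hs]; positivity, hs0⟩
    ⟨hgt, ht'.le⟩ hst'
  linarith

lemma cdf_zero_ne_one (hg_cont : Continuous g) (hg_nonneg : ∀ t, 0 ≤ g t)
    (hg_incr : StrictMonoOn g (Function.support g ∩ Iic 0))
    (hg_int : Integrable g) (hg_one : ∫ t, g t = 1)
    (hG : ∀ y, G y = ∫ t in Iic y, g t) : G 0 ≠ 1 := by
  intro h1
  have hmax : IsLocalMax G 0 := by
    filter_upwards with t
    rw [h1]
    exact cdf_le_one hg_nonneg hg_int hg_one hG t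
  have hg0 := hmax.hasDerivAt_eq_zero (hasDerivAt_cdf hg_cont hg_int hG 0)
  obtain ⟨t, ht, hgt⟩ := exists_mem_ne_zero_of_setIntegral_ne_zero (g := g)
    (s := Iic 0) (by rw [← hG, h1]; norm_num)
  have hpos : 0 < g t := lt_of_le_of_ne (hg_nonneg t) hgt.symm
  have ht' : t ≤ 0 := ht
  obtain ⟨s, ⟨hts, hs0⟩, hs⟩ := intermediate_value_Icc' ht' hg_cont.continuousOn
    (show g t / 2 ∈ Icc (g 0) (g t) by rw [hg0]; constructor <;> linarith)
  have hts' : t < s := lt_of_le_of_ne hts fun h => by rw [← h] at hs; linarith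
  have := hg_incr (a := t) (b := s) ⟨hgt, ht'⟩
    ⟨by rw [Function.mem_support, hs]; positivity, hs0⟩ hts'
  linarith

lemma zero_mem_support (hg_supp : (Function.support g).OrdConnected)
    (hg_int : Integrable g) (hg_one : ∫ t, g t = 1)
    (hG : ∀ y, G y = ∫ t in Iic y, g t) (h0 : G 0 ≠ 0) (h1 : G 0 ≠ 1) : g 0 ≠ 0 := by
  obtain ⟨s, hs, hgs⟩ := exists_mem_ne_zero_of_setIntegral_ne_zero (g := g)
    (s := Iic 0) (by rwa [← hG])
  obtain ⟨t, ht, hgt⟩ := exists_mem_ne_zero_of_setIntegral_ne_zero (g := g)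
    (s := Ioi 0)
    (by rw [← one_sub_cdf hg_int hg_one hG]; exact sub_ne_zero.mpr h1.symm)
  exact hg_supp.out hgs hgt ⟨hs, le_of_lt ht⟩

lemma antitoneOn_Ici_of_support (hg_nonneg : ∀ t, 0 ≤ g t)
    (hg_supp : (Function.support g).OrdConnected)
    (hg_decr : StrictAntiOn g (Function.support g ∩ Ici 0)) (h0 : g 0 ≠ 0) :
    AntitoneOn g (Ici 0) := by
  intro s hs t ht hst
  by_cases hgt : g t = 0
  · rw [hgt]
    exact hg_nonneg s
  · exact hg_decr.antitoneOn ⟨hg_supp.out h0 hgt ⟨hs, hst⟩, hs⟩ ⟨hgt, ht⟩ hst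

lemma monotoneOn_Iic_of_support (hg_nonneg : ∀ t, 0 ≤ g t)
    (hg_supp : (Function.support g).OrdConnected)
    (hg_incr : StrictMonoOn g (Function.support g ∩ Iic 0)) (h0 : g 0 ≠ 0) :
    MonotoneOn g (Iic 0) := by
  intro s hs t ht hst
  by_cases hgs : g s = 0
  · rw [hgs]
    exact hg_nonneg t
  · exact hg_incr.monotoneOn ⟨hgs, hs⟩ ⟨hg_supp.out hgs h0 ⟨hst, ht⟩, ht⟩ hst

lemma lt_of_lt_of_mem_support_Iic (hg_nonneg : ∀ t, 0 ≤ g t)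
    (hg_incr : StrictMonoOn g (Function.support g ∩ Iic 0)) {s t : ℝ} (hst : s < t)
    (ht : t ≤ 0) (hgt : g t ≠ 0) : g s < g t := by
  by_cases hgs : g s = 0
  · rw [hgs]
    exact lt_of_le_of_ne (hg_nonneg t) hgt.symm
  · exact hg_incr ⟨hgs, hst.le.trans ht⟩ ⟨hgt, ht⟩ hst

lemma cdf_sub_le_mul (hd : ∀ y, HasDerivAt G (g y) y) {a b k : ℝ} (hab : a ≤ b)
    (h : ∀ t ∈ Icc a b, g t ≤ k) : G b - G a ≤ k * (b - a) := by
  refine Convex.image_sub_le_mul_sub_of_deriv_le (convex_Icc a b)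
    (fun y _ => (hd y).continuousAt.continuousWithinAt)
    (fun y _ => (hd y).differentiableAt.differentiableWithinAt) ?_
    a (left_mem_Icc.mpr hab) b (right_mem_Icc.mpr hab) hab
  intro y hy
  rw [(hd y).deriv]
  exact h y (interior_subset hy)

lemma mul_le_cdf_sub (hd : ∀ y, HasDerivAt G (g y) y) {a b k : ℝ} (hab : a ≤ b)
    (h : ∀ t ∈ Icc a b, k ≤ g t) : k * (b - a) ≤ G b - G a := by
  refine Convex.mul_sub_le_image_sub_of_le_deriv (convex_Icc a b)
    (fun y _ => (hd y).continuousAt.continuousWithinAt)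
    (fun y _ => (hd y).differentiableAt.differentiableWithinAt) ?_
    a (left_mem_Icc.mpr hab) b (right_mem_Icc.mpr hab) hab
  intro y hy
  rw [(hd y).deriv]
  exact h y (interior_subset hy)

/-- An interval whose right endpoint has the smallest density, and to the right of which the
density is no larger, is shortest among the intervals of the same mass to the right of its left
endpoint. -/
lemma length_le_of_density_le (hd : ∀ y, HasDerivAt G (g y) y) (hmono : Monotone G)
    {A B a b : ℝ} (hAB : A ≤ B) (hB : 0 < g B) (hin : ∀ t ∈ Icc A B, g B ≤ g t)
    (hout : ∀ t, B ≤ t → g t ≤ g B) (hAa : A ≤ a) (hab : a ≤ b)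
    (hmass : G b - G a = G B - G A) : B - A ≤ b - a := by
  have hBb : B ≤ b := by
    by_contra! hlt
    linarith [cdf_lt_of_lt_of_pos_right hd hmono hB.ne' hlt, hmono hAa]
  refine le_of_mul_le_mul_left ?_ hB
  rcases le_total a B with haB | hBa
  · have h₁ := cdf_sub_le_mul hd hBb fun t ht => hout t ht.1
    have h₂ := mul_le_cdf_sub hd hAa fun t ht => hin t ⟨ht.1, ht.2.trans haB⟩
    linarith
  · have h₁ := cdf_sub_le_mul hd hab fun t ht => hout t (hBa.trans ht.1)
    have h₂ := mul_le_cdf_sub hd hAB hin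
    linarith

/-- A lower bound for the length of the intervals of mass `Δ` containing the mode bounds the
length of every interval of mass at least `Δ`. -/
lemma length_le_of_le_mass (hd : ∀ y, HasDerivAt G (g y) y)
    (hanti : AntitoneOn g (Ici 0)) (hmonoOn : MonotoneOn g (Iic 0)) {Δ L : ℝ} (hΔ : 0 < Δ)
    (hmin : ∀ a b : ℝ, 0 ≤ a → 0 ≤ b → G b - G (-a) = Δ → L ≤ a + b)
    {a b : ℝ} (hab : a ≤ b) (hmass : Δ ≤ G b - G a) : L ≤ b - a := by
  have hcont : Continuous G := continuous_iff_continuousAt.mpr fun y => (hd y).continuousAt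
  have key : ∀ a b : ℝ, a ≤ 0 → 0 ≤ b → Δ ≤ G b - G a → L ≤ b - a := by
    intro a b ha hb hm
    rcases le_total Δ (G b - G 0) with h | h
    · obtain ⟨b', ⟨hb', hb'b⟩, hGb'⟩ := intermediate_value_Icc hb hcont.continuousOn
        (show G 0 + Δ ∈ Icc (G 0) (G b) by constructor <;> linarith)
      have := hmin 0 b' le_rfl hb' (by rw [neg_zero]; linarith)
      linarith
    · obtain ⟨a', ⟨haa', ha'⟩, hGa'⟩ := intermediate_value_Icc ha hcont.continuousOn
        (show G b - Δ ∈ Icc (G a) (G 0) by constructor <;> linarith)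
      have := hmin (-a') b (by linarith) hb (by rw [neg_neg]; linarith)
      linarith
  have hshift : ∀ L y : ℝ, HasDerivAt (fun s => G (s + L) - G s) (g (y + L) - g y) y :=
    fun L y => ((hd (y + L)).comp_add_const y L).sub (hd y)
  rcases le_total a 0 with ha | ha
  · rcases le_total 0 b with hb | hb
    · exact key a b ha hb hmass
    · have han : AntitoneOn (fun s => G (s + (a - b)) - G s) (Iic 0) := by
        refine antitoneOn_of_deriv_nonpos (convex_Iic 0)
          (fun y _ => (hshift _ y).continuousAt.continuousWithinAt)
          (fun y _ => (hshift _ y).differentiableAt.differentiableWithinAt) fun y hy => ?_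
        have hy0 : y ∈ Iic (0 : ℝ) := interior_subset hy
        rw [(hshift _ y).deriv, sub_nonpos]
        exact hmonoOn (show y + (a - b) ≤ 0 by linarith [mem_Iic.mp hy0]) hy0 (by linarith)
      have h := han hb self_mem_Iic hb
      simp only [zero_add, add_sub_cancel] at h
      have := key (a - b) 0 (by linarith) le_rfl (by linarith)
      linarith
  · have han : AntitoneOn (fun s => G (s + (b - a)) - G s) (Ici 0) := by
      refine antitoneOn_of_deriv_nonpos (convex_Ici 0)
        (fun y _ => (hshift _ y).continuousAt.continuousWithinAt)
        (fun y _ => (hshift _ y).differentiableAt.differentiableWithinAt) fun y hy => ?_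
      have hy0 : y ∈ Ici (0 : ℝ) := interior_subset hy
      rw [(hshift _ y).deriv, sub_nonpos]
      exact hanti hy0 (show 0 ≤ y + (b - a) by linarith [mem_Ici.mp hy0]) (by linarith)
    have h := han self_mem_Ici ha ha
    simp only [zero_add, add_sub_cancel] at h
    have := key 0 (b - a) le_rfl (by linarith) (by linarith)
    linarith

/-- The density takes equal values at the two endpoints of a shortest interval of given mass. -/
lemma density_endpoints_eq (hd : ∀ y, HasDerivAt G (g y) y) (hmono : Monotone G)
    {a b Δ : ℝ} (hΔ : 0 < Δ) (hmass : G b - G a = Δ)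
    (hmin : ∀ s t : ℝ, s ≤ t → Δ ≤ G t - G s → b - a ≤ t - s) : g b = g a := by
  have hcont : Continuous G := continuous_iff_continuousAt.mpr fun y => (hd y).continuousAt
  have hab : a ≤ b := by
    by_contra! h
    linarith [hmono h.le]
  have hmax : IsLocalMax (fun s => G (b + s) - G (a + s)) 0 := by
    filter_upwards with s
    simp only [add_zero, hmass]
    by_contra! hlt
    obtain ⟨t, ⟨hat, htb⟩, ht⟩ := intermediate_value_Icc (show a + s ≤ b + s by linarith)
      hcont.continuousOn (show G (a + s) + Δ ∈ Icc (G (a + s)) (G (b + s)) by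
        constructor <;> linarith)
    have hle := hmin (a + s) t hat (by linarith)
    have : t = b + s := by linarith
    rw [this] at ht
    linarith
  have hder : HasDerivAt (fun s => G (b + s) - G (a + s)) (g (b + 0) - g (a + 0)) 0 :=
    ((hd (b + 0)).comp_const_add b 0).sub ((hd (a + 0)).comp_const_add a 0)
  have := hmax.hasDerivAt_eq_zero hder
  simp only [add_zero] at this
  linarith

lemma withDensity_truncated_Icc_toReal (hg_cont : Continuous g) (hg_nonneg : ∀ t, 0 ≤ g t)
    (hg_int : Integrable g) (hG : ∀ y, G y = ∫ t in Iic y, g t) {m c K : ℝ} (hc : 0 < c)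
    (hK : 0 < K) {l u : ℝ} (hl : 0 ≤ l) (hlu : l ≤ u) :
    (volume.withDensity (fun y => ENNReal.ofReal (Set.indicator (Ici 0)
        (fun z => g ((z - m)/c) / (c * K)) y)) (Icc l u)).toReal
      = (G ((u - m) / c) - G ((l - m) / c)) / K := by
  have hcont : Continuous fun z => g ((z - m) / c) / (c * K) := by fun_prop
  have hnn : ∀ z, 0 ≤ g ((z - m) / c) / (c * K) := fun z =>
    div_nonneg (hg_nonneg _) (mul_pos hc hK).le
  rw [withDensity_apply _ measurableSet_Icc,
    setLIntegral_congr_fun (g := fun z => ENNReal.ofReal (g ((z - m) / c) / (c * K)))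
      measurableSet_Icc (fun z hz => by
        simp only [indicator_of_mem (show z ∈ Ici (0 : ℝ) from hl.trans hz.1)]),
    ← ofReal_integral_eq_lintegral_ofReal
      (hcont.continuousOn.integrableOn_compact isCompact_Icc)
      (Eventually.of_forall hnn),
    ENNReal.toReal_ofReal (integral_nonneg hnn), integral_Icc_eq_integral_Ioc,
    ← intervalIntegral.integral_of_le hlu, intervalIntegral.integral_div,
    cdf_sub_eq hg_int hG]
  have h : (∫ x in l..u, g ((x - m) / c)) = c * ∫ x in (l - m) / c..(u - m) / c, g x := by
    have := intervalIntegral.integral_comp_div_sub (a := l) (b := u) g hc.ne' (m / c)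
    simpa [sub_div] using this
  rw [h, mul_div_mul_left _ _ hc.ne']

end UnimodalDensity

/-- Lemma 5 of the paper: form of the HPD (shortest) `1 - α` credible interval for the
truncation to `[0, ∞)` of a unimodal (not necessarily symmetric) location–scale density.
Case (i) arises when `G(0) = 0`, or `0 < G(0) < 1` and `m/c ≤ y₀`; case (ii) arises when
`G(0) = 1`, or `0 < G(0) < 1` and `m/c ≥ y₀`. -/
theorem stmt11 (α : ℝ) (hα : α ∈ Set.Ioo (0:ℝ) 1)
    (g G Ginv : ℝ → ℝ)
    (hg_cont : Continuous g)
    (hg_nonneg : ∀ t, 0 ≤ g t)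
    (hg_supp : (Function.support g).OrdConnected)
    (hg_incr : StrictMonoOn g (Function.support g ∩ Iic 0))
    (hg_decr : StrictAntiOn g (Function.support g ∩ Ici 0))
    (hg_int : Integrable g)
    (hg_one : ∫ t, g t = 1)
    (hG : ∀ y, G y = ∫ t in Iic y, g t)
    (hGinv : ∀ p : ℝ, 0 < p → p < 1 →
      Ginv p ∈ interior (Function.support g) ∧ G (Ginv p) = p)
    (γ₁ γ₂ : ℝ → ℝ)
    (hγ : ∀ Δ : ℝ, 0 < Δ → Δ < 1 →
      0 ≤ γ₁ Δ ∧ 0 ≤ γ₂ Δ ∧ G (γ₂ Δ) - G (-(γ₁ Δ)) = Δ ∧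
        ∀ a b : ℝ, 0 ≤ a → 0 ≤ b → G b - G (-a) = Δ → γ₁ Δ + γ₂ Δ ≤ a + b)
    (U : ℝ → ℝ)
    (hU : ∀ y, U y = -y + γ₁ ((1 - α) * (1 - G (-y))))
    (y₀ : ℝ)
    (hy₀ : 0 < G 0 → G 0 < 1 →
      -y₀ ∈ interior (Function.support g) ∧ U y₀ = 0)
    (m c : ℝ) (hc : 0 < c) (hm : 0 < 1 - G (-(m/c)))
    (μ : Measure ℝ)
    (hμ : μ = volume.withDensity
      (fun y => ENNReal.ofReal (Set.indicator (Ici 0)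
        (fun z => g ((z - m)/c) / (c * (1 - G (-(m/c))))) y))) :
    ((G 0 = 0 ∨ (0 < G 0 ∧ G 0 < 1 ∧ m/c ≤ y₀)) →
      (μ (Icc 0 (m + c * Ginv (1 - α + α * G (-(m/c)))))).toReal = 1 - α ∧
      ∀ l u : ℝ, 0 ≤ l → l ≤ u → (μ (Icc l u)).toReal = 1 - α →
        (m + c * Ginv (1 - α + α * G (-(m/c)))) - 0 ≤ u - l) ∧
    ((G 0 = 1 ∨ (0 < G 0 ∧ G 0 < 1 ∧ y₀ ≤ m/c)) →
      (μ (Icc (m - c * γ₁ ((1 - α) * (1 - G (-(m/c)))))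
              (m + c * γ₂ ((1 - α) * (1 - G (-(m/c))))))).toReal = 1 - α ∧
      ∀ l u : ℝ, 0 ≤ l → l ≤ u → (μ (Icc l u)).toReal = 1 - α →
        (m + c * γ₂ ((1 - α) * (1 - G (-(m/c)))))
          - (m - c * γ₁ ((1 - α) * (1 - G (-(m/c))))) ≤ u - l) := by
  have hd := hasDerivAt_cdf hg_cont hg_int hG
  have hmono := monotone_of_hasDerivAt hg_nonneg hd
  have hne0 := cdf_zero_ne_zero hg_cont hg_nonneg hg_decr hg_int hg_one hG
  have hne1 := cdf_zero_ne_one hg_cont hg_nonneg hg_incr hg_int hg_one hG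
  have hg0 := zero_mem_support hg_supp hg_int hg_one hG hne0 hne1
  have hanti := antitoneOn_Ici_of_support hg_nonneg hg_supp hg_decr hg0
  have hmonoOn := monotoneOn_Iic_of_support hg_nonneg hg_supp hg_incr hg0
  have hG0 := cdf_nonneg hg_nonneg hG
  have hG1 := cdf_le_one hg_nonneg hg_int hg_one hG
  obtain ⟨hα0, hα1⟩ := hα
  have hΔ : ∀ q, 0 ≤ q → q < 1 → 0 < (1 - α) * (1 - q) ∧ (1 - α) * (1 - q) < 1 :=
    fun q h0 h1 => ⟨mul_pos (by linarith) (by linarith), by nlinarith⟩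
  have hshort : ∀ Δ, 0 < Δ → Δ < 1 → ∀ s t : ℝ, s ≤ t → Δ ≤ G t - G s →
      γ₁ Δ + γ₂ Δ ≤ t - s := fun Δ h0 h1 s t hst hm =>
    length_le_of_le_mass hd hanti hmonoOn h0 (hγ Δ h0 h1).2.2.2 hst hm
  have hend : ∀ Δ, 0 < Δ → Δ < 1 → g (γ₂ Δ) = g (-γ₁ Δ) := fun Δ h0 h1 =>
    density_endpoints_eq hd hmono h0 (hγ Δ h0 h1).2.2.1 fun s t hst hm => by
      linarith [hshort Δ h0 h1 s t hst hm]
  obtain ⟨hy_mem, hUy⟩ := hy₀ (lt_of_le_of_ne (hG0 0) hne0.symm) (lt_of_le_of_ne (hG1 0) hne1)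
  have hgy : g (-y₀) ≠ 0 := interior_subset hy_mem
  have hGy : G (-y₀) < 1 :=
    (cdf_lt_of_lt_of_pos_left hd hmono hgy (lt_add_one _)).trans_le (hG1 _)
  obtain ⟨hD0, hD1⟩ := hΔ _ (hG0 (-y₀)) hGy
  rw [hU] at hUy
  obtain ⟨hz1, hz2, hz3, -⟩ := hγ _ hD0 hD1
  have hz4 := hend _ hD0 hD1
  rw [show γ₁ ((1 - α) * (1 - G (-y₀))) = y₀ by linarith] at hz1 hz3 hz4
  set z₀ := γ₂ ((1 - α) * (1 - G (-y₀)))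
  set x := m / c with hx
  set q := G (-x)
  obtain ⟨hE0, hE1⟩ := hΔ q (hG0 _) (by linarith)
  have hmu : ∀ l u : ℝ, 0 ≤ l → l ≤ u →
      (μ (Icc l u)).toReal = (G ((u - m) / c) - G ((l - m) / c)) / (1 - q) :=
    fun l u hl hlu => by
      rw [hμ]
      exact withDensity_truncated_Icc_toReal hg_cont hg_nonneg hg_int hG hc hm hl hlu
  have hmul : m = c * x := by rw [hx]; field_simp
  have hmass : ∀ l u : ℝ, 0 ≤ l → l ≤ u → (μ (Icc l u)).toReal = 1 - α →
      G ((u - m) / c) - G ((l - m) / c) = (1 - α) * (1 - q) := fun l u hl hlu h => by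
    rwa [hmu l u hl hlu, div_eq_iff hm.ne'] at h
  have hlen : ∀ l u L : ℝ, L ≤ (u - m) / c - (l - m) / c → c * L ≤ u - l := fun l u L h => by
    rw [← sub_div, le_div_iff₀ hc] at h
    linarith
  constructor
  · intro hcase
    have hxy : x ≤ y₀ := by
      rcases hcase with h | h
      · exact absurd h hne0
      · exact h.2.2
    obtain ⟨hzint, hzG⟩ := hGinv (1 - α + α * q) (by nlinarith [hG0 (-x)]) (by nlinarith)
    set z := Ginv (1 - α + α * q)
    have hgz : g z ≠ 0 := interior_subset hzint
    have hxz : -x ≤ z := by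
      by_contra! h
      have := hmono h.le
      nlinarith
    have hzz : 0 ≤ z ∧ ∀ t ∈ Icc (-x) z, g z ≤ g t := by
      rcases le_total x 0 with hx0 | hx0
      · refine ⟨by linarith, fun t ht => ?_⟩
        exact hanti (show 0 ≤ t by linarith [ht.1]) (show 0 ≤ z by linarith) ht.2
      · have hz0z : z₀ ≤ z := by
          by_contra! h
          have h₁ := cdf_lt_of_lt_of_pos_left hd hmono hgz h
          have h₂ : G (-y₀) ≤ q := hmono (by linarith)
          nlinarith
        have hz : 0 ≤ z := hz2.trans hz0z
        refine ⟨hz, fun t ht => ?_⟩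
        rcases le_total 0 t with ht0 | ht0
        · exact hanti ht0 hz ht.2
        · have h₁ : g z ≤ g z₀ := hanti hz2 hz hz0z
          have h₂ : g (-y₀) ≤ g t := hmonoOn (show -y₀ ≤ 0 by linarith) ht0 (by linarith [ht.1])
          linarith
    have hlow : ((0 : ℝ) - m) / c = -x := by rw [hx]; ring
    have hupp : (m + c * z - m) / c = z := by field_simp; ring
    refine ⟨?_, fun l u hl hlu h => ?_⟩
    · rw [hmu 0 _ le_rfl (by rw [hmul]; nlinarith), hlow, hupp, hzG, div_eq_iff hm.ne']
      ring
    · have hle : -x ≤ (l - m) / c := by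
        rw [← hlow]
        gcongr
      have := length_le_of_density_le hd hmono hxz (lt_of_le_of_ne (hg_nonneg _) hgz.symm)
        hzz.2 (fun t ht => hanti hzz.1 (hzz.1.trans ht) ht) hle
        (show (l - m) / c ≤ (u - m) / c by gcongr)
        (by rw [hmass l u hl hlu h, hzG]; ring)
      have := hlen l u _ this
      rw [hmul]
      linarith
  · intro hcase
    have hxy : y₀ ≤ x := by
      rcases hcase with h | h
      · exact absurd h hne1
      · exact h.2.2
    obtain ⟨h1, h2, h3, -⟩ := hγ _ hE0 hE1
    have h4 := hend _ hE0 hE1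
    have hs := hshort _ hE0 hE1
    set Δ := (1 - α) * (1 - q) with hΔdef
    have hγx : γ₁ Δ ≤ x := by
      by_contra! hlt
      have hlt' : g (γ₂ Δ) < g z₀ := by
        rw [h4, hz4]
        exact lt_of_lt_of_mem_support_Iic hg_nonneg hg_incr (by linarith) (by linarith) hgy
      have hz : z₀ < γ₂ Δ := by
        by_contra! hle
        exact absurd (hanti h2 hz2 hle) (not_le.mpr hlt')
      have i1 := cdf_lt_of_lt_of_pos_left hd hmono (hz4 ▸ hgy) hz
      have i2 : G (-γ₁ Δ) ≤ q := hmono (by linarith)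
      have i3 : q ≤ G (-y₀) := hmono (by linarith)
      nlinarith
    have hlow : (m - c * γ₁ Δ - m) / c = -γ₁ Δ := by field_simp; ring
    have hupp : (m + c * γ₂ Δ - m) / c = γ₂ Δ := by field_simp; ring
    refine ⟨?_, fun l u hl hlu h => ?_⟩
    · rw [hmu _ _ (by rw [hmul]; nlinarith) (by nlinarith), hlow, hupp, h3, div_eq_iff hm.ne']
    · have := hlen l u _ (hs _ _ (show (l - m) / c ≤ (u - m) / c by gcongr)
        (hmass l u hl hlu h).ge)
      linarith
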